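/- arXiv:math/0303200 — 5 statements merged into one kernel-verified Lean document; each statement's English description precedes it below -/
import Mathlib

section
/- The kernel of π is generated by the binomials it contains: ker π = Ideal.span { X^m − λ·X^n | m, n : I →₀ ℕ, λ ∈ k, λ ≠ 0, and X^m − λ·X^n ∈ ker π }, where X^m denotes the monomial with exponent m and coefficient 1. In particular, since S is an integral domain, the kernel of π is a prime ideal generated by binomials. -/
open MvPolynomial

/-- The image of a monomial under evaluation at homogeneous elements is homogeneous. -/
theorem aeval_monomial_one_mem_graded
    {k : Type*} [CommSemiring k] {Φ : Type*} [AddCommMonoid Φ]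
    {S : Type*} [CommSemiring S] [Algebra k S] (𝒜 : Φ → Submodule k S) [SetLike.GradedMonoid 𝒜]
    {I : Type*} {d : I → Φ} {g : I → S} (hg : ∀ i, g i ∈ 𝒜 (d i)) (m : I →₀ ℕ) :
    aeval g (monomial m (1 : k)) ∈ 𝒜 (m.sum fun i e => e • d i) := by
  rw [aeval_monomial, map_one, one_mul]
  exact SetLike.prod_pow_mem_graded 𝒜 d g m fun i _ => hg i

/-- Evaluation at nonzero elements of a domain does not kill monomials. -/
theorem aeval_monomial_one_ne_zero
    {k : Type*} [CommSemiring k] {S : Type*} [CommSemiring S] [IsDomain S] [Algebra k S]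
    {I : Type*} {g : I → S} (hg0 : ∀ i, g i ≠ 0) (m : I →₀ ℕ) :
    aeval g (monomial m (1 : k)) ≠ 0 := by
  rw [aeval_monomial, map_one, one_mul]
  exact Finset.prod_ne_zero_iff.2 fun i _ => pow_ne_zero _ (hg0 i)

/-- Two nonzero elements of a submodule of dimension at most one are proportional. -/
theorem exists_ne_zero_smul_eq_of_rank_le_one
    {k : Type*} [Field k] {M : Type*} [AddCommGroup M] [Module k M] {N : Submodule k M}
    (hN : Module.rank k N ≤ 1) {x y : M} (hx : x ∈ N) (hy : y ∈ N) (hx0 : x ≠ 0) (hy0 : y ≠ 0) :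
    ∃ c : k, c ≠ 0 ∧ x = c • y := by
  obtain ⟨v, -, hv⟩ := (rank_submodule_le_one_iff N).1 hN
  obtain ⟨r, rfl⟩ := Submodule.mem_span_singleton.1 (hv hx)
  obtain ⟨s, rfl⟩ := Submodule.mem_span_singleton.1 (hv hy)
  have hr : r ≠ 0 := fun h => hx0 (by simp [h])
  have hs : s ≠ 0 := fun h => hy0 (by simp [h])
  exact ⟨r / s, div_ne_zero hr hs, by rw [smul_smul, div_mul_cancel₀ r hs]⟩

/-- If `f` is killed by evaluation at nonzero homogeneous elements of a graded domain, then every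
monomial of `f` shares its degree with another monomial of `f`. -/
theorem exists_mem_support_sum_smul_eq
    {k : Type*} [Field k] {Φ : Type*} [AddCommMonoid Φ] [DecidableEq Φ]
    {S : Type*} [CommRing S] [IsDomain S] [Algebra k S] (𝒜 : Φ → Submodule k S) [GradedAlgebra 𝒜]
    {I : Type*} {d : I → Φ} {g : I → S} (hg : ∀ i, g i ∈ 𝒜 (d i)) (hg0 : ∀ i, g i ≠ 0)
    {f : MvPolynomial I k} (hf : aeval g f = 0) {m : I →₀ ℕ} (hm : m ∈ f.support) :
    ∃ n ∈ f.support, n ≠ m ∧ (n.sum fun i e => e • d i) = m.sum fun i e => e • d i := by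
  by_contra! h
  have hsum : aeval g f = ∑ n ∈ f.support, coeff n f • aeval g (monomial n (1 : k)) := by
    conv_lhs => rw [f.as_sum, map_sum]
    refine Finset.sum_congr rfl fun n _ => ?_
    rw [← map_smul, smul_monomial, smul_eq_mul, mul_one]
  have hmem (n : I →₀ ℕ) := (𝒜 (n.sum fun i e => e • d i)).smul_mem (coeff n f)
    (aeval_monomial_one_mem_graded 𝒜 hg n)
  have hcomp : GradedRing.proj 𝒜 (m.sum fun i e => e • d i) (aeval g f) =
      coeff m f • aeval g (monomial m (1 : k)) := by
    rw [hsum, map_sum, Finset.sum_eq_single_of_mem m hm, GradedRing.proj_apply,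
      DirectSum.decompose_of_mem_same 𝒜 (hmem m)]
    intro n hn hnm
    rw [GradedRing.proj_apply, DirectSum.decompose_of_mem_ne 𝒜 (hmem n) (h n hn hnm)]
  rw [hf, map_zero] at hcomp
  exact smul_ne_zero (mem_support_iff.1 hm) (aeval_monomial_one_ne_zero hg0 m) hcomp.symm

/-- Let `S` be a `Φ`-graded integral `k`-algebra all of whose homogeneous
components have dimension at most `1`, and let `π : k[X_i] → S` be a surjection sending each
variable to a nonzero homogeneous element.  Then the kernel of `π` is generated by the binomials
`X^m − λ·X^n` which it contains. -/
theorem ker_generated_by_binomials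
    {k : Type*} [Field k] {Φ : Type*} [AddCommMonoid Φ] [DecidableEq Φ]
    {S : Type*} [CommRing S] [IsDomain S] [Algebra k S]
    (𝒜 : Φ → Submodule k S) [GradedAlgebra 𝒜]
    (hdim : ∀ φ : Φ, Module.rank k ↥(𝒜 φ) ≤ 1)
    {I : Type*} (d : I → Φ) (g : I → S)
    (hg : ∀ i : I, g i ∈ 𝒜 (d i)) (hg0 : ∀ i : I, g i ≠ 0)
    (hsurj : Function.Surjective ⇑(MvPolynomial.aeval (R := k) g)) :
    RingHom.ker (MvPolynomial.aeval (R := k) g : MvPolynomial I k →ₐ[k] S)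
      = Ideal.span {p : MvPolynomial I k |
          ∃ (m n : I →₀ ℕ) (lam : k), lam ≠ 0 ∧
            p = MvPolynomial.monomial m (1 : k) - MvPolynomial.monomial n lam ∧
            p ∈ RingHom.ker (MvPolynomial.aeval (R := k) g : MvPolynomial I k →ₐ[k] S)} := by
  classical
  refine le_antisymm (fun f hf => ?_) (Ideal.span_le.2 ?_)
  · induction hN : f.support.card using Nat.strong_induction_on generalizing f with
    | _ N ih =>
      subst hN
      obtain rfl | hf0 := eq_or_ne f 0
      · exact zero_mem _
      obtain ⟨m, hm⟩ := Finset.nonempty_iff_ne_empty.2 (support_eq_empty.not.2 hf0)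
      obtain ⟨n, hn, hnm, hdeg⟩ :=
        exists_mem_support_sum_smul_eq 𝒜 hg hg0 (RingHom.mem_ker.1 hf) hm
      obtain ⟨c, hc, hmn⟩ := exists_ne_zero_smul_eq_of_rank_le_one (hdim _)
        (aeval_monomial_one_mem_graded 𝒜 hg m)
        (hdeg ▸ aeval_monomial_one_mem_graded 𝒜 hg n)
        (aeval_monomial_one_ne_zero hg0 m) (aeval_monomial_one_ne_zero hg0 n)
      set b : MvPolynomial I k := monomial m 1 - monomial n c with hb
      have hbker : b ∈ RingHom.ker (aeval g : MvPolynomial I k →ₐ[k] S) := by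
        rw [RingHom.mem_ker, hb, map_sub, hmn, ← map_smul, smul_monomial, smul_eq_mul, mul_one,
          sub_self]
      have hbspan := Ideal.subset_span (s := {p : MvPolynomial I k |
          ∃ (m n : I →₀ ℕ) (lam : k), lam ≠ 0 ∧ p = monomial m (1 : k) - monomial n lam ∧
            p ∈ RingHom.ker (aeval g : MvPolynomial I k →ₐ[k] S)}) ⟨m, n, c, hc, hb, hbker⟩
      have hlt : (f - C (coeff m f) * b).support ⊂ f.support := by
        refine (Finset.ssubset_iff_of_subset fun l hl => ?_).2 ⟨m, hm, ?_⟩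
        · by_contra hlf
          have hml : m ≠ l := fun h => hlf (h ▸ hm)
          have hnl : n ≠ l := fun h => hlf (h ▸ hn)
          rw [mem_support_iff] at hl
          exact hl (by simp [hb, coeff_C_mul, coeff_monomial, hml, hnl, notMem_support_iff.1 hlf])
        · simp [hb, coeff_C_mul, coeff_monomial, hnm]
      rw [← sub_add_cancel f (C (coeff m f) * b)]
      exact add_mem
        (ih _ (Finset.card_lt_card hlt) _ (sub_mem hf (Ideal.mul_mem_left _ _ hbker)) rfl)
        (Ideal.mul_mem_left _ _ hbspan)
  · rintro p ⟨-, -, -, -, -, hp⟩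
    exact hp
end

section
/- A is integral over A': every element of A is a root of a monic polynomial with coefficients in the subring A' of elements supported in degrees belonging to Φ'. -/
/-- The subring of elements all of whose nonzero homogeneous components have degree in `H`. -/
def GradedRing.degreewiseSubring {Φ : Type*} [AddCommGroup Φ] [DecidableEq Φ]
    {A : Type*} [CommRing A] (𝒜 : Φ → AddSubgroup A) [GradedRing 𝒜] (H : AddSubgroup Φ) :
    Subring A where
  carrier := {a | ∀ φ ∉ H, (DirectSum.decompose 𝒜 a φ : A) = 0}
  zero_mem' φ _ := by simp
  one_mem' φ hφ :=
    DirectSum.decompose_of_mem_ne 𝒜 SetLike.GradedOne.one_mem fun h ↦ hφ (h ▸ H.zero_mem)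
  add_mem' {a b} ha hb φ hφ := by
    simp [DirectSum.decompose_add, ha φ hφ, hb φ hφ]
  neg_mem' {a} ha φ hφ := by
    rw [DirectSum.decompose_neg]
    exact neg_eq_zero.mpr (ha φ hφ)
  mul_mem' {a b} ha hb φ hφ := by
    classical
    rw [DirectSum.decompose_mul, DirectSum.coe_mul_apply]
    refine Finset.sum_eq_zero fun ij hij ↦ ?_
    have hsum : ij.1 + ij.2 = φ := (Finset.mem_filter.mp hij).2
    by_cases h₁ : ij.1 ∈ H
    · have h₂ : ij.2 ∉ H := fun h₂ ↦ hφ (hsum ▸ H.add_mem h₁ h₂)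
      rw [hb _ h₂, mul_zero]
    · rw [ha _ h₁, zero_mul]

theorem GradedRing.mem_degreewiseSubring_of_mem {Φ : Type*} [AddCommGroup Φ] [DecidableEq Φ]
    {A : Type*} [CommRing A] (𝒜 : Φ → AddSubgroup A) [GradedRing 𝒜] {H : AddSubgroup Φ}
    {φ : Φ} (hφ : φ ∈ H) {a : A} (ha : a ∈ 𝒜 φ) : a ∈ degreewiseSubring 𝒜 H :=
  fun _ hψ ↦ DirectSum.decompose_of_mem_ne 𝒜 ha fun h ↦ hψ (h ▸ hφ)

/-- Let `A` be a ring graded by an abelian group `Φ` and let `Φ'` be a subgroup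
of `Φ` with `Φ/Φ'` torsion.  Then `A` is integral over the subring
`A' = ⊕_{φ ∈ Φ'} 𝒜 φ`: every element of `A` is a root of a monic polynomial all of whose
coefficients have all their homogeneous components of degree outside `Φ'` equal to zero. -/
theorem integral_over_degreewise_subring
    {Φ : Type*} [AddCommGroup Φ] [DecidableEq Φ]
    {A : Type*} [CommRing A]
    (𝒜 : Φ → AddSubgroup A) [GradedRing 𝒜]
    (Φ' : AddSubgroup Φ)
    (htor : ∀ φ : Φ, ∃ n : ℕ, 0 < n ∧ n • φ ∈ Φ') :
    ∀ a : A, ∃ p : Polynomial A, p.Monic ∧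
      (∀ (n : ℕ) (φ : Φ), φ ∉ Φ' → ((DirectSum.decompose 𝒜 (p.coeff n)) φ : A) = 0) ∧
      Polynomial.eval a p = 0 := by
  intro a
  have hint : IsIntegral (GradedRing.degreewiseSubring 𝒜 Φ') a := by
    classical
    rw [← DirectSum.sum_support_decompose 𝒜 a]
    refine IsIntegral.sum _ fun φ _ ↦ ?_
    obtain ⟨n, hn, hnφ⟩ := htor φ
    refine IsIntegral.of_pow hn ?_
    exact isIntegral_algebraMap (R := GradedRing.degreewiseSubring 𝒜 Φ')
      (x := ⟨_, GradedRing.mem_degreewiseSubring_of_mem 𝒜 hnφ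
        (SetLike.pow_mem_graded n (DirectSum.decompose 𝒜 a φ).2)⟩)
  obtain ⟨p, hp, hpa⟩ := hint
  refine ⟨p.map (algebraMap _ A), hp.map _, fun n φ hφ ↦ ?_, ?_⟩
  · rw [Polynomial.coeff_map]
    exact (p.coeff n).2 φ hφ
  · rwa [Polynomial.eval_map]
end

section
/- For d ≥ 1, the additive submonoid of nonnegative elements of ℤ^d with the lexicographic order is generated by the elements e_j^{(i)} for 1 ≤ i ≤ d−1 and j = 0, 1, 2, … together with e_0^{(d)}, where e_j^{(i)} is the vector with entry 1 in coordinate i, entry −j in coordinate i+1, and 0 elsewhere, and e_0^{(d)} = (0, …, 0, 1). That is, AddSubmonoid.closure of this set of vectors equals {x ∈ ℤ^d | 0 ≤ x in the lexicographic order}. -/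
/-- A vector whose first possibly nonzero coordinate is `i`, where it is positive, is
lexicographically positive. -/
theorem toLex_pos_of_leading {ι : Type*} [LinearOrder ι] {x : ι → ℤ} (i : ι)
    (h0 : ∀ l < i, x l = 0) (hi : 0 < x i) : 0 < toLex x :=
  ⟨i, fun l hl => (h0 l hl).symm, hi⟩

/-- A submonoid of `ℤ^d` containing every `e_i - j e_{i+1}` and the last basis vector contains each
lexicographically nonnegative vector whose coordinates before `k` vanish. -/
theorem toLex_mem_of_nonneg_of_vanish_below {d : ℕ} (S : AddSubmonoid (Lex (Fin d → ℤ)))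
    (hS : ∀ (i i' : Fin d) (j : ℕ), i.val + 1 = i'.val →
      toLex (Pi.single i (1 : ℤ) + Pi.single i' (-(j : ℤ))) ∈ S)
    (hlast : ∀ i : Fin d, i.val + 1 = d → toLex (Pi.single i (1 : ℤ)) ∈ S)
    (n k : ℕ) (hk : k + n + 1 = d) (x : Fin d → ℤ) (h0 : ∀ l : Fin d, l.val < k → x l = 0)
    (hx : 0 ≤ toLex x) : toLex x ∈ S := by
  have hkd : k < d := by omega
  induction n generalizing k x with
  | zero =>
    have hxk : 0 ≤ x ⟨k, hkd⟩ :=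
      Pi.apply_le_of_toLex (x := (0 : Fin d → ℤ)) (y := x) (i := ⟨k, hkd⟩) hx
        fun l hl => (h0 l hl).symm
    obtain ⟨m, hm⟩ := Int.eq_ofNat_of_zero_le hxk
    convert S.nsmul_mem (hlast ⟨k, hkd⟩ hk) m using 1
    change x = m • (Pi.single (⟨k, hkd⟩ : Fin d) (1 : ℤ) : Fin d → ℤ)
    ext l
    rcases eq_or_ne l ⟨k, hkd⟩ with rfl | hl
    · simp [hm]
    · have := Fin.val_ne_of_ne hl
      rw [h0 l (by grind)]
      simp [hl]
  | succ n ih =>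
    have hkd' : k + 1 < d := by omega
    have hxk : 0 ≤ x ⟨k, hkd⟩ :=
      Pi.apply_le_of_toLex (x := (0 : Fin d → ℤ)) (y := x) (i := ⟨k, hkd⟩) hx
        fun l hl => (h0 l hl).symm
    rcases hxk.eq_or_lt with hxk | hxk
    · refine ih (k + 1) (by omega) x (fun l hl => ?_) hx hkd'
      rcases Nat.lt_succ_iff_lt_or_eq.mp hl with hl | hl
      · exact h0 l hl
      · rw [hxk]
        congr 1
        exact Fin.ext hl
    · obtain ⟨m, hm⟩ := Int.eq_ofNat_of_zero_le (Int.sub_nonneg_of_le hxk)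
      let j := (x ⟨k + 1, hkd'⟩).natAbs + 1
      let y : Fin d → ℤ := Function.update (x + Pi.single ⟨k + 1, hkd'⟩ (j : ℤ)) ⟨k, hkd⟩ 0
      have hy0 (l : Fin d) (hl : l.val < k + 1) : y l = 0 := by
        rcases eq_or_ne l ⟨k, hkd⟩ with rfl | hlk
        · simp [y]
        · have := Fin.val_ne_of_ne hlk
          have hl' : l ≠ ⟨k + 1, hkd'⟩ := by grind
          simp [y, hlk, hl', h0 l (by grind)]
      have hy : 0 ≤ toLex y := by
        refine (toLex_pos_of_leading ⟨k + 1, hkd'⟩ (fun l hl => hy0 l hl) ?_).le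
        have : 0 < x ⟨k + 1, hkd'⟩ + (j : ℤ) := by omega
        simpa [y] using this
      convert S.add_mem (S.add_mem (hS ⟨k, hkd⟩ ⟨k + 1, hkd'⟩ j rfl)
          (S.nsmul_mem (hS ⟨k, hkd⟩ ⟨k + 1, hkd'⟩ 0 rfl) m))
        (ih (k + 1) (by omega) y hy0 hy hkd') using 1
      change x = (Pi.single (⟨k, hkd⟩ : Fin d) (1 : ℤ) + Pi.single ⟨k + 1, hkd'⟩ (-(j : ℤ)))
        + m • (Pi.single (⟨k, hkd⟩ : Fin d) (1 : ℤ) + Pi.single ⟨k + 1, hkd'⟩ (-((0 : ℕ) : ℤ))) + y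
      ext l
      rcases eq_or_ne l ⟨k, hkd⟩ with rfl | hlk
      · simp [y]
        omega
      · rcases eq_or_ne l ⟨k + 1, hkd'⟩ with rfl | hl'
        · simp [y]
        · simp [y, hlk, hl']

/-- For `d ≥ 1`, the submonoid of nonnegative elements of `ℤ^d` with the
lexicographic order is generated by the vectors `e_j^{(i)}` (entry `1` in coordinate `i`,
entry `−j` in coordinate `i+1`, `0` elsewhere, for `1 ≤ i ≤ d−1` and `j ∈ ℕ`) together with
`e_0^{(d)} = (0, …, 0, 1)`. -/
theorem lex_nonneg_submonoid_generators (d : ℕ) (hd : 1 ≤ d) :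
    (AddSubmonoid.closure
        ({x : Lex (Fin d → ℤ) | ∃ (i : ℕ) (hi : i + 1 < d) (j : ℕ),
            x = toLex (Pi.single (⟨i, by omega⟩ : Fin d) (1 : ℤ)
              + Pi.single (⟨i + 1, hi⟩ : Fin d) (-(j : ℤ)))}
          ∪ {toLex (Pi.single (⟨d - 1, by omega⟩ : Fin d) (1 : ℤ))}) : Set (Lex (Fin d → ℤ)))
      = {x : Lex (Fin d → ℤ) | 0 ≤ x} := by
  apply Set.Subset.antisymm
  · change _ ≤ AddSubmonoid.nonneg (Lex (Fin d → ℤ))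
    refine AddSubmonoid.closure_le.mpr ?_
    rintro _ (⟨i, hi, j, rfl⟩ | rfl)
    · refine (toLex_pos_of_leading (⟨i, by omega⟩ : Fin d) (fun l hl => ?_) (by simp)).le
      have hl₁ : l ≠ ⟨i, by omega⟩ := hl.ne
      have hl₂ : l ≠ ⟨i + 1, hi⟩ := (hl.trans (Nat.lt_succ_self i)).ne
      simp [hl₁, hl₂]
    · exact (toLex_pos_of_leading (⟨d - 1, by omega⟩ : Fin d)
        (fun l hl => Pi.single_eq_of_ne hl.ne _) (by simp)).le
  · intro x hx
    exact toLex_mem_of_nonneg_of_vanish_below _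
      (fun i i' j h => AddSubmonoid.subset_closure (Or.inl ⟨i, h ▸ i'.isLt, j, by simp only [h]⟩))
      (fun i h => AddSubmonoid.subset_closure (Or.inr
        (congrArg (fun l => toLex (Pi.single l (1 : ℤ))) (Fin.ext (Nat.eq_sub_of_add_eq h)))))
      (d - 1) 0 (by omega) (ofLex x) (fun _ hl => absurd hl (Nat.not_lt_zero _)) hx
end

section
/- For every valuation subring O₀ of K containing R, there exists a valuation subring O of K with R ⊆ O ⊆ O₀ such that O dominates R and the residue extension of O over R is trivial: every valuation of R specializes to a rational valuation. -/
/-- Membership in the maximal ideal of a valuation subring `O` of `K`, viewed as a subset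
of `K`: the element belongs to `O` and is a nonunit there. -/
def ValuationSubring.MemMaxIdeal {K : Type*} [Field K] (O : ValuationSubring K) (a : K) : Prop :=
  ∃ h : a ∈ O, (⟨a, h⟩ : ↥O) ∈ _root_.nonunits ↥O

namespace ValuationSubring

variable {K : Type*} [Field K]

theorem memMaxIdeal_iff_mem_nonunits (O : ValuationSubring K) (a : K) :
    O.MemMaxIdeal a ↔ a ∈ O.nonunits :=
  mem_nonunits_iff_exists_mem_maximalIdeal.symm

theorem not_mem_of_inv_mem_nonunits {O : ValuationSubring K} {a : K} (ha : a ≠ 0)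
    (h : a⁻¹ ∈ O.nonunits) : a ∉ O :=
  (O.inv_mem_nonunits_iff.mp h).resolve_left ha

/-- A proper ideal of a ring mapping to the residue field of a valuation ring `O` can be
centred on a valuation ring contained in `O`. -/
theorem exists_le_of_residue (O : ValuationSubring K) {A : Type*} [CommRing A]
    (f : A →+* IsLocalRing.ResidueField O) (J : Ideal A) (hJ : ∀ x ∈ J, f x ≠ 1) :
    ∃ V : ValuationSubring K, V ≤ O ∧ ∀ (a : O) (x : A), IsLocalRing.residue O a = f x →
      (a : K) ∈ V ∧ (x ∈ J → (a : K) ∈ V.nonunits) := by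
  let J' : Ideal f.range := J.map f.rangeRestrict
  have hJ' (y : f.range) (hy : y ∈ J') : ∃ x ∈ J, f x = y := by
    obtain ⟨x, hx, rfl⟩ := (Ideal.mem_map_iff_of_surjective _ f.rangeRestrict_surjective).mp hy
    exact ⟨x, hx, rfl⟩
  have hJ'_ne : J' ≠ ⊤ := by
    intro h
    obtain ⟨x, hx, hx1⟩ := hJ' 1 (h ▸ Submodule.mem_top)
    exact hJ x hx hx1
  let B₀ : Subring O := f.range.comap (IsLocalRing.residue O)
  let B : Subring K := B₀.map O.subtype
  have hB : B ≤ O.toSubring := by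
    rintro _ ⟨a, -, rfl⟩
    exact a.2
  let g : B →+* f.range :=
    ((IsLocalRing.residue O).comp (Subring.inclusion hB)).codRestrict f.range (by
      rintro ⟨_, a, ha, rfl⟩
      exact ha)
  obtain ⟨V, hBV, hV⟩ :=
    Ideal.image_subset_nonunits_valuationSubring (J'.comap g) (Ideal.comap_ne_top g hJ'_ne)
  have key (a : O) (x : A) (hax : IsLocalRing.residue O a = f x) :
      (a : K) ∈ V ∧ (x ∈ J → (a : K) ∈ V.nonunits) := by
    have haB : (a : K) ∈ B := ⟨a, ⟨x, hax.symm⟩, rfl⟩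
    refine ⟨hBV haB, fun hx ↦ hV ⟨⟨a, haB⟩, ?_, rfl⟩⟩
    have : g ⟨a, haB⟩ = f.rangeRestrict x := Subtype.ext hax
    simpa only [SetLike.mem_coe, Ideal.mem_comap, this] using Ideal.mem_map_of_mem _ hx
  refine ⟨V, fun a ha ↦ ?_, key⟩
  by_contra haO
  have ha0 : a ≠ 0 := fun h ↦ haO (h ▸ O.zero_mem)
  have hmem : a⁻¹ ∈ O.nonunits := O.inv_mem_nonunits_iff.mpr (.inr haO)
  obtain ⟨hinv, hmax⟩ := mem_nonunits_iff_exists_mem_maximalIdeal.mp hmem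
  have hres : IsLocalRing.residue O ⟨a⁻¹, hinv⟩ = f 0 := by
    rw [map_zero, IsLocalRing.residue_eq_zero_iff]
    exact hmax
  exact not_mem_of_inv_mem_nonunits ha0 ((key _ 0 hres).2 J.zero_mem) ha

/-- The intersection of a nonempty chain of valuation subrings is a valuation subring. -/
theorem exists_mem_iff_forall_mem_of_isChain {c : Set (ValuationSubring K)}
    (hc : IsChain (· ≤ ·) c) : ∃ V : ValuationSubring K, ∀ a, a ∈ V ↔ ∀ W ∈ c, a ∈ W := by
  refine ⟨ofSubring (⨅ W ∈ c, W.toSubring) fun a ↦ ?_, fun a ↦ ?_⟩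
  · simp only [Subring.mem_iInf, mem_toSubring]
    by_contra! h
    obtain ⟨⟨V, hV, haV⟩, W, hW, haW⟩ := h
    rcases hc.total hV hW with hle | hle
    · exact haW (hle ((V.mem_or_inv_mem a).resolve_left haV))
    · exact haV (hle ((W.mem_or_inv_mem a).resolve_right haW))
  · simp only [mem_ofSubring, Subring.mem_iInf, mem_toSubring]

variable {R : Type*} [CommRing R] [IsLocalRing R] [Algebra R K]

/-- A valuation subring containing a local ring contains a minimal one among those dominating
the local ring. -/
theorem exists_minimal_dominating (O₀ : ValuationSubring K)
    (h₀ : ∀ x : R, algebraMap R K x ∈ O₀) :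
    ∃ O ≤ O₀, Minimal (fun V : ValuationSubring K ↦ (∀ x : R, algebraMap R K x ∈ V) ∧
      ∀ x ∈ IsLocalRing.maximalIdeal R, algebraMap R K x ∈ V.nonunits) O := by
  let S : Set (ValuationSubring K) := {V | (∀ x : R, algebraMap R K x ∈ V) ∧
      ∀ x ∈ IsLocalRing.maximalIdeal R, algebraMap R K x ∈ V.nonunits}
  obtain ⟨V, hVO, hV⟩ := O₀.exists_le_of_residue
    ((IsLocalRing.residue O₀).comp ((algebraMap R K).codRestrict O₀.toSubring h₀))
    (IsLocalRing.maximalIdeal R) (by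
      intro x hx h
      have hu : IsUnit (1 - x) := (IsLocalRing.isUnit_or_isUnit_one_sub_self x).resolve_left hx
      refine (hu.map ((IsLocalRing.residue O₀).comp
        ((algebraMap R K).codRestrict O₀.toSubring h₀))).ne_zero ?_
      rw [map_sub, map_one, h, sub_self])
  have hVS : V ∈ S := ⟨fun x ↦ (hV ⟨_, h₀ x⟩ x rfl).1, fun x hx ↦ (hV ⟨_, h₀ x⟩ x rfl).2 hx⟩
  obtain ⟨O, hOV, hO⟩ := zorn_le_nonempty₀ (α := (ValuationSubring K)ᵒᵈ) S (by
    intro c hcS hc W hW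
    obtain ⟨I, hI⟩ := exists_mem_iff_forall_mem_of_isChain (K := K) hc.symm
    refine ⟨I, ⟨fun x ↦ (hI _).mpr fun U hU ↦ (hcS hU).1 x, fun x hx ↦ ?_⟩,
      fun U hU a ha ↦ (hI a).mp ha U hU⟩
    have hxW := (hcS hW).2 x hx
    exact I.mem_nonunits_iff_or.mpr <| ((mem_nonunits_iff_or W.ofDual).mp hxW).imp_right
      fun h h' ↦ h ((hI _).mp h' W hW)) V hVS
  exact ⟨O, le_trans hOV hVO, hO.1, fun U hU hUO ↦ hO.2 hU hUO⟩

/-- A valuation subring which is minimal among those dominating a local ring with algebraically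
closed coefficient field has trivial residue extension. -/
theorem residue_surjective_of_minimal {k : Type*} [Field k] [IsAlgClosed k] (i : k →+* R)
    (hi : Function.Surjective ((IsLocalRing.residue R).comp i)) {O : ValuationSubring K}
    (hO : Minimal (fun V : ValuationSubring K ↦ (∀ x : R, algebraMap R K x ∈ V) ∧
      ∀ x ∈ IsLocalRing.maximalIdeal R, algebraMap R K x ∈ V.nonunits) O) :
    Function.Surjective ((IsLocalRing.residue O).comp
      (((algebraMap R K).codRestrict O.toSubring hO.1.1).comp i)) := by
  let j : k →+* IsLocalRing.ResidueField O := (IsLocalRing.residue O).comp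
    (((algebraMap R K).codRestrict O.toSubring hO.1.1).comp i)
  let : Algebra k (IsLocalRing.ResidueField O) := j.toAlgebra
  suffices h : Algebra.IsAlgebraic k (IsLocalRing.ResidueField O) from
    (IsAlgClosed.algebraMap_bijective_of_isIntegral (k := k)).2
  refine ⟨fun t ↦ ?_⟩
  by_contra ht
  have hinj := transcendental_iff_injective.mp ht
  obtain ⟨V, hVO, hV⟩ := O.exists_le_of_residue
    (Polynomial.aeval (R := k) t).toRingHom (Ideal.span {Polynomial.X}) (by
      intro p hp h
      have hp1 : p = 1 := hinj (h.trans (map_one _).symm)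
      rw [Ideal.mem_span_singleton, hp1] at hp
      exact Polynomial.not_isUnit_X (isUnit_of_dvd_one hp))
  have hmax (x : R) (hx : x ∈ IsLocalRing.maximalIdeal R) :
      IsLocalRing.residue O ⟨algebraMap R K x, hO.1.1 x⟩ = 0 := by
    obtain ⟨_, h⟩ := mem_nonunits_iff_exists_mem_maximalIdeal.mp (hO.1.2 x hx)
    exact (IsLocalRing.residue_eq_zero_iff _).mpr h
  have hOV : O ≤ V := by
    refine hO.2 ⟨fun x ↦ ?_, fun x hx ↦ ?_⟩ hVO
    · obtain ⟨c, hc⟩ := hi (IsLocalRing.residue R x)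
      refine (hV ⟨_, hO.1.1 x⟩ (Polynomial.C c) ?_).1
      have hxc : x - i c ∈ IsLocalRing.maximalIdeal R := by
        rw [← IsLocalRing.residue_eq_zero_iff, map_sub, ← hc, RingHom.comp_apply, sub_self]
      have h := hmax _ hxc
      have hsub : (⟨algebraMap R K (x - i c), hO.1.1 _⟩ : O) =
          ⟨algebraMap R K x, hO.1.1 x⟩ - ⟨algebraMap R K (i c), hO.1.1 _⟩ :=
        Subtype.ext (map_sub _ _ _)
      rw [hsub, map_sub, sub_eq_zero] at h
      exact h.trans (Polynomial.aeval_C t c).symm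
    · exact (hV ⟨_, hO.1.1 x⟩ 0 ((hmax x hx).trans (map_zero _).symm)).2 (Ideal.zero_mem _)
  obtain ⟨a, rfl⟩ := IsLocalRing.residue_surjective t
  have haV := (hV a Polynomial.X (Polynomial.aeval_X _).symm).2
    (Ideal.mem_span_singleton_self _)
  have haO : IsUnit a := by
    by_contra h
    refine ht ?_
    rw [(IsLocalRing.residue_eq_zero_iff a).mpr h]
    exact isAlgebraic_zero
  obtain ⟨_, h⟩ := mem_nonunits_iff_exists_mem_maximalIdeal.mp haV
  exact h (haO.map (inclusion O V hOV))

end ValuationSubring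

/-- Let `R` be a noetherian local domain with an algebraically closed
coefficient field `k` and fraction field `K` of finite transcendence degree over `k`.  Then
every valuation subring `O₀` of `K` containing `R` specializes to a rational valuation: there
is a valuation subring `O ⊆ O₀` containing `R`, dominating `R`, with trivial residue
extension. -/
theorem specialize_to_rational_valuation
    {R K : Type*} [CommRing R] [IsDomain R] [IsNoetherianRing R] [IsLocalRing R]
    [Field K] [Algebra R K] [IsFractionRing R K]
    (k : Type*) [Field k] [IsAlgClosed k] [Algebra k R] [Algebra k K] [IsScalarTower k R K]
    (hres : Function.Bijective ((IsLocalRing.residue R).comp (algebraMap k R)))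
    (htd : ∃ s : Finset K, ∀ a : K, IsAlgebraic (↥(Algebra.adjoin k (s : Set K))) a) :
    ∀ O₀ : ValuationSubring K, (∀ x : R, algebraMap R K x ∈ O₀) →
      ∃ O : ValuationSubring K, O ≤ O₀ ∧
        (∀ x : R, algebraMap R K x ∈ O) ∧
        (∀ x : R, O.MemMaxIdeal (algebraMap R K x) ↔ x ∈ IsLocalRing.maximalIdeal R) ∧
        (∀ a : K, a ∈ O → ∃ x : R, O.MemMaxIdeal (a - algebraMap R K x)) := by
  intro O₀ h₀
  obtain ⟨O, hOO₀, hO⟩ := O₀.exists_minimal_dominating h₀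
  refine ⟨O, hOO₀, hO.1.1, fun x ↦ ⟨?_, fun hx ↦ ?_⟩, fun a ha ↦ ?_⟩
  · rintro ⟨_, h⟩ hx
    exact h (hx.map ((algebraMap R K).codRestrict O.toSubring hO.1.1))
  · exact (O.memMaxIdeal_iff_mem_nonunits _).mpr (hO.1.2 x hx)
  · obtain ⟨c, hc⟩ := ValuationSubring.residue_surjective_of_minimal (algebraMap k R) hres.2 hO
      (IsLocalRing.residue O ⟨a, ha⟩)
    refine ⟨algebraMap k R c, sub_mem ha (hO.1.1 _), ?_⟩
    refine (IsLocalRing.residue_eq_zero_iff (R := O)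
      (⟨a, ha⟩ - ⟨algebraMap R K (algebraMap k R c), hO.1.1 _⟩)).mp ?_
    rw [map_sub, sub_eq_zero]
    exact hc.symm
end

section
/- The graded inclusion f is scalewise birational: for every φ ∈ Φ and every nonzero homogeneous element b ∈ G'_φ, there exist degrees φ₁, φ₂ ∈ Φ, nonzero homogeneous elements x ∈ G_{φ₁} and y ∈ G_{φ₂}, and a nonzero scalar c ∈ k, such that f(y)·b = c·f(x); in particular every nonzero homogeneous element of G' is a quotient of images of homogeneous elements of G up to a scalar, so G and G' have the same field of fractions. -/
/-- In a graded domain, every element of the group generated by the support is a difference of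
two degrees of the support. -/
theorem exists_ne_zero_mem_of_mem_closure_support
    {k : Type*} [Field k] {Φ : Type*} [AddCommGroup Φ] [DecidableEq Φ]
    {G : Type*} [CommRing G] [IsDomain G] [Algebra k G]
    (𝒜 : Φ → Submodule k G) [GradedAlgebra 𝒜] {φ : Φ}
    (hφ : φ ∈ AddSubgroup.closure {φ : Φ | 𝒜 φ ≠ ⊥}) :
    ∃ (φ₁ φ₂ : Φ) (x y : G), x ∈ 𝒜 φ₁ ∧ y ∈ 𝒜 φ₂ ∧ x ≠ 0 ∧ y ≠ 0 ∧ φ₂ + φ = φ₁ := by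
  have one_mem : (1 : G) ∈ 𝒜 0 := SetLike.GradedOne.one_mem
  induction hφ using AddSubgroup.closure_induction with
  | mem φ h =>
    obtain ⟨x, hx, hx0⟩ := (Submodule.ne_bot_iff _).1 h
    exact ⟨φ, 0, x, 1, hx, one_mem, hx0, one_ne_zero, zero_add φ⟩
  | zero => exact ⟨0, 0, 1, 1, one_mem, one_mem, one_ne_zero, one_ne_zero, zero_add 0⟩
  | add φ ψ _ _ hφ hψ =>
    obtain ⟨φ₁, φ₂, x, y, hx, hy, hx0, hy0, rfl⟩ := hφ
    obtain ⟨ψ₁, ψ₂, z, w, hz, hw, hz0, hw0, rfl⟩ := hψ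
    exact ⟨_, _, x * z, y * w, SetLike.mul_mem_graded hx hz, SetLike.mul_mem_graded hy hw,
      mul_ne_zero hx0 hz0, mul_ne_zero hy0 hw0, by abel⟩
  | neg φ _ hφ =>
    obtain ⟨φ₁, φ₂, x, y, hx, hy, hx0, hy0, rfl⟩ := hφ
    exact ⟨_, _, y, x, hy, hx, hy0, hx0, by abel⟩

/-- Two nonzero vectors of a subspace of dimension at most one are proportional. -/
theorem Submodule.exists_smul_eq_of_rank_le_one
    {k V : Type*} [Field k] [AddCommGroup V] [Module k V] {W : Submodule k V}
    (hW : Module.rank k W ≤ 1) {u v : V} (hu : u ∈ W) (hv : v ∈ W) (hu0 : u ≠ 0)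
    (hv0 : v ≠ 0) : ∃ c : k, c ≠ 0 ∧ u = c • v := by
  obtain ⟨w, -, hw⟩ := rank_submodule_le_one_iff W |>.1 hW
  obtain ⟨a, rfl⟩ := Submodule.mem_span_singleton.1 (hw hu)
  obtain ⟨b, rfl⟩ := Submodule.mem_span_singleton.1 (hw hv)
  have ha : a ≠ 0 := left_ne_zero_of_smul hu0
  have hb : b ≠ 0 := left_ne_zero_of_smul hv0
  exact ⟨a / b, div_ne_zero ha hb, by rw [smul_smul, div_mul_cancel₀ a hb]⟩

/-- A graded injection `f : G → G'` of `Φ`-graded integral `k`-algebras with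
homogeneous components of dimension at most one, whose support generates `Φ` as a group, is
scalewise birational: every nonzero homogeneous element `b ∈ G'_φ` satisfies
`f(y)·b = c·f(x)` for some nonzero homogeneous `x, y ∈ G` and a nonzero scalar `c ∈ k`. -/
theorem graded_inclusion_birational
    {k : Type*} [Field k] {Φ : Type*} [AddCommGroup Φ] [DecidableEq Φ]
    {G G' : Type*} [CommRing G] [IsDomain G] [Algebra k G]
    [CommRing G'] [IsDomain G'] [Algebra k G']
    (𝒜 : Φ → Submodule k G) [GradedAlgebra 𝒜]
    (𝒜' : Φ → Submodule k G') [GradedAlgebra 𝒜']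
    (hdim : ∀ φ : Φ, Module.rank k ↥(𝒜 φ) ≤ 1)
    (hdim' : ∀ φ : Φ, Module.rank k ↥(𝒜' φ) ≤ 1)
    (f : G →ₐ[k] G') (hinj : Function.Injective ⇑f)
    (hgraded : ∀ φ : Φ, ∀ x ∈ 𝒜 φ, f x ∈ 𝒜' φ)
    (hgen : AddSubgroup.closure {φ : Φ | 𝒜 φ ≠ ⊥} = ⊤) :
    ∀ φ : Φ, ∀ b ∈ 𝒜' φ, b ≠ 0 →
      ∃ (φ₁ φ₂ : Φ) (x y : G) (c : k),
        x ∈ 𝒜 φ₁ ∧ y ∈ 𝒜 φ₂ ∧ x ≠ 0 ∧ y ≠ 0 ∧ c ≠ 0 ∧ f y * b = c • f x := by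
  intro φ b hb hb0
  obtain ⟨φ₁, φ₂, x, y, hx, hy, hx0, hy0, rfl⟩ :=
    exists_ne_zero_mem_of_mem_closure_support 𝒜 (φ := φ) (hgen ▸ AddSubgroup.mem_top φ)
  have hf {z : G} (hz : z ≠ 0) : f z ≠ 0 := (map_ne_zero_iff f hinj).2 hz
  obtain ⟨c, hc0, hc⟩ := Submodule.exists_smul_eq_of_rank_le_one (hdim' _)
    (SetLike.mul_mem_graded (hgraded _ y hy) hb) (hgraded _ x hx)
    (mul_ne_zero (hf hy0) hb0) (hf hx0)
  exact ⟨_, _, x, y, c, hx, hy, hx0, hy0, hc0, hc⟩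
end
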